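/- arXiv:2601.18126 — 4 statements merged into one kernel-verified Lean document; each statement's English description precedes it below -/
import Mathlib

section
/- Define the non-holomorphic completion Ĝ₂(τ) = G₂(τ) − 1/(8π·Im τ) for τ ∈ ℍ. Then Ĝ₂ transforms as a modular form of weight two: Ĝ₂(τ+1) = Ĝ₂(τ) and Ĝ₂(−1/τ) = τ²·Ĝ₂(τ) for every τ ∈ ℍ. -/
open Complex Filter

noncomputable section

/-- Jacobi theta function θ00(z,τ) = Σ_{n∈ℤ} exp(πin²τ + 2πinz). -/
def θ00 (z τ : ℂ) : ℂ :=
  ∑' n : ℤ, Complex.exp ((Real.pi : ℂ) * I * n ^ 2 * τ + 2 * (Real.pi : ℂ) * I * n * z)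

/-- Jacobi theta function θ01(z,τ) = Σ_{n∈ℤ} (−1)^n exp(πin²τ + 2πinz). -/
def θ01 (z τ : ℂ) : ℂ :=
  ∑' n : ℤ, (-1 : ℂ) ^ n *
    Complex.exp ((Real.pi : ℂ) * I * n ^ 2 * τ + 2 * (Real.pi : ℂ) * I * n * z)

/-- Jacobi theta function θ10(z,τ) = Σ_{n∈ℤ} exp(πi(n+1/2)²τ + (2n+1)πiz). -/
def θ10 (z τ : ℂ) : ℂ :=
  ∑' n : ℤ, Complex.exp ((Real.pi : ℂ) * I * (n + 1 / 2) ^ 2 * τ +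
    (2 * n + 1) * (Real.pi : ℂ) * I * z)

/-- Jacobi theta function θ11(z,τ) = Σ_{n∈ℤ} (−1)^n exp(πi(n+1/2)²τ + (2n+1)πiz). -/
def θ11 (z τ : ℂ) : ℂ :=
  ∑' n : ℤ, (-1 : ℂ) ^ n * Complex.exp ((Real.pi : ℂ) * I * (n + 1 / 2) ^ 2 * τ +
    (2 * n + 1) * (Real.pi : ℂ) * I * z)

/-- Dedekind eta function η(τ) = q^{1/24} ∏_{n≥1} (1 − qⁿ), q = exp(2πiτ). -/
def η (τ : ℂ) : ℂ :=
  Complex.exp ((Real.pi : ℂ) * I * τ / 12) *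
    ∏' n : ℕ, (1 - Complex.exp (2 * (Real.pi : ℂ) * I * τ) ^ (n + 1))

/-- Weight-two quasimodular Eisenstein series G₂(τ) = 1/24 − Σ_{n≥1} σ₁(n) qⁿ. -/
def G₂ (τ : ℂ) : ℂ :=
  1 / 24 - ∑' n : ℕ, (∑ d ∈ (n + 1).divisors, (d : ℂ)) *
    Complex.exp (2 * (Real.pi : ℂ) * I * τ) ^ (n + 1)

/-- The non-holomorphic completion `Ĝ₂(τ) = G₂(τ) − 1/(8π·Im τ)`. -/
def G₂hat (τ : ℂ) : ℂ := G₂ τ - 1 / (8 * (Real.pi : ℂ) * (τ.im : ℂ))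

theorem G₂_eq_G2 (z : UpperHalfPlane) :
    EisensteinSeries.G2 z = 8 * (Real.pi : ℂ) ^ 2 * G₂ (z : ℂ) := by
  rw [EisensteinSeries.G2_eq_tsum_cexp, G₂, riemannZeta_two,
    tsum_pnat_eq_tsum_succ (f := fun n : ℕ => (ArithmeticFunction.sigma 1 n : ℂ) *
      Complex.exp (2 * (Real.pi : ℂ) * I * z) ^ n)]
  simp only [ArithmeticFunction.sigma_one_apply, Nat.cast_sum]
  ring

/-- `Ĝ₂` transforms as a modular form of weight two: `Ĝ₂(τ+1) = Ĝ₂(τ)` and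
`Ĝ₂(−1/τ) = τ²·Ĝ₂(τ)`. -/
theorem G₂hat_modular (τ : ℂ) (hτ : 0 < τ.im) :
    G₂hat (τ + 1) = G₂hat τ ∧ G₂hat (-1 / τ) = τ ^ 2 * G₂hat τ := by
  have hpi : (Real.pi : ℂ) ≠ 0 := by exact_mod_cast Real.pi_ne_zero
  constructor
  · have h : Complex.exp (2 * (Real.pi : ℂ) * I * (τ + 1)) =
        Complex.exp (2 * (Real.pi : ℂ) * I * τ) := by
      rw [mul_add, mul_one, Complex.exp_add, Complex.exp_two_pi_mul_I, mul_one]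
    simp [G₂hat, G₂, h]
  · have h0 : τ ≠ 0 := by
      rintro rfl
      simp at hτ
    let z : UpperHalfPlane := ⟨τ, hτ⟩
    have hz : (z : ℂ) = τ := rfl
    have hS : ((ModularGroup.S • z : UpperHalfPlane) : ℂ) = -1 / τ := by
      rw [UpperHalfPlane.modular_S_smul]
      simp [hz, neg_div]
    have h1 := EisensteinSeries.G2_S_transform z
    rw [G₂_eq_G2, G₂_eq_G2, hS, hz] at h1
    have hy : (τ.im : ℂ) ≠ 0 := by exact_mod_cast hτ.ne'
    have him : ((-1 / τ).im : ℂ) = τ.im / (τ * (starRingEnd ℂ) τ) := by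
      rw [Complex.mul_conj, neg_div, one_div, Complex.neg_im, Complex.inv_im]
      push_cast
      ring
    have hc : (starRingEnd ℂ) τ ≠ 0 := by simpa using h0
    have hcc : (starRingEnd ℂ) τ = τ - 2 * τ.im * I := by
      apply Complex.ext <;> simp
      ring
    have h2 : G₂ (-1 / τ) = τ ^ 2 * G₂ τ - I * τ / (4 * Real.pi) := by
      field_simp at h1 ⊢
      linear_combination -h1 / 2
    rw [G₂hat, G₂hat, h2, him]
    have h3 : 1 / (8 * (Real.pi : ℂ) * (τ.im / (τ * (starRingEnd ℂ) τ))) =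
        τ * (starRingEnd ℂ) τ / (8 * Real.pi * τ.im) := by
      field_simp
    rw [h3, hcc]
    field_simp
    ring

end
end

section
/- For all z ∈ ℂ and τ ∈ ℍ, the function θ11/η³ transforms under the modular inversion τ ↦ −1/τ with a projective factor: θ11(z/τ, −1/τ)/η(−1/τ)³ = (exp(πiz²/τ)/τ) · θ11(z,τ)/η(τ)³. -/
open Complex Filter

noncomputable section

lemma aux_theta (z τ : ℂ) : θ11 z τ =
    Complex.exp ((Real.pi : ℂ) * I * τ / 4 + (Real.pi : ℂ) * I * z) *
      jacobiTheta₂ (z + τ / 2 + 1 / 2) τ := by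
  unfold θ11 jacobiTheta₂ jacobiTheta₂_term
  rw [← tsum_mul_left]
  refine tsum_congr fun n => ?_
  have h : (-1 : ℂ) ^ n = Complex.exp (n * ((Real.pi : ℂ) * I)) := by
    rw [Complex.exp_int_mul, Complex.exp_pi_mul_I]
  rw [h, ← Complex.exp_add, ← Complex.exp_add]
  congr 1
  ring

lemma aux_sqrt (τ : ℂ) (hτ : 0 < τ.im) :
    (Complex.sqrt I)⁻¹ * Complex.sqrt τ = (-I * τ) ^ (1 / 2 : ℂ) := by
  have h0 : τ ≠ 0 := by rintro rfl; simp at hτ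
  have hl : Complex.log (-I * τ) = Complex.log (-I) + Complex.log τ := by
    apply Complex.log_mul (by simp) h0
    have h1 : 0 ≤ τ.arg := Complex.arg_nonneg_iff.2 hτ.le
    have h2 := Complex.arg_le_pi τ
    rw [Complex.arg_neg_I]
    constructor <;> linarith [Real.pi_pos]
  rw [Complex.sqrt, Complex.sqrt, Complex.cpow_def_of_ne_zero I_ne_zero,
    Complex.cpow_def_of_ne_zero h0, ← Complex.exp_neg, ← Complex.exp_add,
    Complex.cpow_def_of_ne_zero (by simp [h0]), hl, Complex.log_neg_I, Complex.log_I]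
  congr 1
  ring

lemma aux_eta (τ : ℂ) : η τ = ModularForm.eta τ := by
  unfold η ModularForm.eta
  simp only [ModularForm.eta_q_eq_pow]
  congr 2
  simp [Function.Periodic.qParam]
  ring

lemma aux_eta_S (τ : ℂ) (hτ : 0 < τ.im) : η (-1 / τ) = (-I * τ) ^ (1 / 2 : ℂ) * η τ := by
  have := ModularForm.eta_comp_eq_csqrt_I_inv (x := τ) hτ
  simp only [Function.comp, Pi.smul_apply, Pi.mul_apply, smul_eq_mul] at this
  rw [aux_eta, aux_eta, this, ← aux_sqrt τ hτ, mul_assoc]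

lemma aux_theta_S (z τ : ℂ) (hτ : 0 < τ.im) : θ11 (z / τ) (-1 / τ) =
    -I * (-I * τ) ^ (1 / 2 : ℂ) * Complex.exp ((Real.pi : ℂ) * I * z ^ 2 / τ) * θ11 z τ := by
  have h0 : τ ≠ 0 := by rintro rfl; simp at hτ
  have hs : (-I * τ) ^ (1 / 2 : ℂ) ≠ 0 := by simp [Complex.cpow_eq_zero_iff, h0]
  have hI : -I = Complex.exp (-(Real.pi / 2 * I)) := by
    rw [Complex.exp_neg, Complex.exp_pi_div_two_mul_I, Complex.inv_I]
  rw [aux_theta, aux_theta, jacobiTheta₂_functional_equation (z + τ / 2 + 1 / 2) τ,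
    show z / τ + -1 / τ / 2 + 1 / 2 = (z + τ / 2 + 1 / 2) / τ + -1 / τ by field_simp; ring,
    jacobiTheta₂_add_left']
  generalize jacobiTheta₂ _ _ = J
  generalize (-I * τ) ^ (1 / 2 : ℂ) = s at *
  rw [show -I * s * cexp (Real.pi * I * z ^ 2 / τ) *
      (cexp (Real.pi * I * τ / 4 + Real.pi * I * z) *
        (1 / s * cexp (-Real.pi * I * (z + τ / 2 + 1 / 2) ^ 2 / τ) * J)) =
      (-I * cexp (Real.pi * I * z ^ 2 / τ) * cexp (Real.pi * I * τ / 4 + Real.pi * I * z) *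
        cexp (-Real.pi * I * (z + τ / 2 + 1 / 2) ^ 2 / τ)) * J by field_simp,
    ← mul_assoc, hI]
  simp only [← Complex.exp_add]
  congr 2
  field_simp
  ring

/-- Under the modular inversion `τ ↦ −1/τ`:
`θ11(z/τ,−1/τ)/η(−1/τ)³ = (e^{πiz²/τ}/τ)·θ11(z,τ)/η(τ)³`. -/
theorem θ11_div_eta_cubed_S_transform (z τ : ℂ) (hτ : 0 < τ.im) :
    θ11 (z / τ) (-1 / τ) / η (-1 / τ) ^ 3
      = Complex.exp ((Real.pi : ℂ) * I * z ^ 2 / τ) / τ * (θ11 z τ / η τ ^ 3) := by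
  have h0 : τ ≠ 0 := by rintro rfl; simp at hτ
  have hs : (-I * τ) ^ (1 / 2 : ℂ) ≠ 0 := by simp [Complex.cpow_eq_zero_iff, h0]
  have hs2 : ((-I * τ) ^ (1 / 2 : ℂ)) ^ 2 = -I * τ := by
    rw [← Complex.cpow_nat_mul]; simp
  have he : η τ ≠ 0 := by rw [aux_eta]; exact ModularForm.eta_ne_zero hτ
  rw [aux_theta_S z τ hτ, aux_eta_S τ hτ]
  generalize (-I * τ) ^ (1 / 2 : ℂ) = s at *
  rw [show (s * η τ) ^ 3 = s * (s ^ 2) * η τ ^ 3 by ring, hs2]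
  field_simp

end
end

section
/- Product expansion of θ11: for all z ∈ ℂ and τ ∈ ℍ, Σ_{n∈ℤ} (−1)^n exp(πi(n+1/2)²τ + (2n+1)πiz) = q^{1/8}·(e^{πiz} − e^{−πiz})·∏_{n=1}^∞ (1 − q^n)(1 − q^n e^{2πiz})(1 − q^n e^{−2πiz}), where q^{1/8} = exp(πiτ/4), and the infinite product converges. -/
open Complex Filter

noncomputable section

/-- Gaussian binomial coefficient. -/
def qbin (q : ℂ) : ℕ → ℕ → ℂ
  | _, 0 => 1
  | 0, _ + 1 => 0
  | m + 1, k + 1 => qbin q m (k + 1) + q ^ (m - k) * qbin q m k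

lemma qbin_zero (q : ℂ) (m : ℕ) : qbin q m 0 = 1 := by
  cases m <;> rfl

lemma qbin_succ (q : ℂ) (m k : ℕ) :
    qbin q (m + 1) (k + 1) = qbin q m (k + 1) + q ^ (m - k) * qbin q m k := rfl

lemma qbin_gt (q : ℂ) (m : ℕ) : ∀ k, m < k → qbin q m k = 0 := by
  induction m with
  | zero => intro k hk; cases k with
    | zero => omega
    | succ k => rfl
  | succ m ih => intro k hk; cases k with
    | zero => omega
    | succ k => rw [qbin_succ, ih _ (by omega), ih _ (by omega)]; simp

/-- finite product (q;q)_n -/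
def qP (q : ℂ) (n : ℕ) : ℂ := ∏ i ∈ Finset.range n, (1 - q ^ (i + 1))

lemma qP_succ (q : ℂ) (n : ℕ) : qP q (n + 1) = qP q n * (1 - q ^ (n + 1)) :=
  Finset.prod_range_succ _ _

lemma qbin_self (q : ℂ) (m : ℕ) : qbin q m m = 1 := by
  induction m with
  | zero => rfl
  | succ m ih => rw [qbin_succ, ih, qbin_gt _ _ _ (by omega)]; simp

lemma qbin_mul (q : ℂ) (n : ℕ) : ∀ k l, k + l = n →
    qbin q n k * (qP q k * qP q l) = qP q n := by
  induction n with
  | zero =>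
    intro k l h
    obtain rfl : k = 0 := by omega
    obtain rfl : l = 0 := by omega
    simp [qP, qbin_zero]
  | succ n ih =>
    intro k l h
    rcases k with _ | k
    · obtain rfl : l = n + 1 := by omega
      simp [qP, qbin_zero]
    rcases l with _ | l
    · obtain rfl : k = n := by omega
      rw [qbin_self]; simp [qP]
    have h1 := ih (k + 1) l (by omega)
    have h2 := ih k (l + 1) (by omega)
    have h3 : n - k = l + 1 := by omega
    have h4 : n = k + l + 1 := by omega
    rw [qP_succ] at h1 h2
    rw [qbin_succ, h3, qP_succ, qP_succ, qP_succ q n]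
    have h5 : q ^ (n + 1) = q ^ (k + 1) * q ^ (l + 1) := by rw [← pow_add]; congr 1; omega
    rw [h5]
    linear_combination (1 - q ^ (l + 1)) * h1 + q ^ (l + 1) * (1 - q ^ (k + 1)) * h2

lemma qbinomial (q w : ℂ) (hq : q ≠ 0) (f : ℤ → ℂ)
    (hf : ∀ j, f (j + 1) = -w * q ^ (j + 1) * f j) (N m : ℕ) :
    f (-N) * ∏ k ∈ Finset.range m, (1 - w * q ^ (1 - N + k : ℤ)) =
      ∑ k ∈ Finset.range (m + 1), f (k - N) * qbin q m k := by
  induction m with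
  | zero => simp [qbin_zero]
  | succ m ih =>
    rw [Finset.prod_range_succ, ← mul_assoc, ih, Finset.sum_range_succ' _ (m + 1)]
    simp only [qbin_succ, mul_add, Finset.sum_add_distrib]
    have e1 : ∑ k ∈ Finset.range (m + 1), f ((k + 1 : ℕ) - N) * (q ^ (m - k) * qbin q m k) =
        -w * q ^ (1 - N + m : ℤ) * ∑ k ∈ Finset.range (m + 1), f (k - N) * qbin q m k := by
      rw [Finset.mul_sum]
      refine Finset.sum_congr rfl fun k hk => ?_
      have hk' : k ≤ m := by simpa [Nat.lt_succ_iff] using hk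
      have : ((k + 1 : ℕ) - N : ℤ) = (k - N : ℤ) + 1 := by push_cast; ring
      rw [this, hf]
      have h2 : q ^ (1 - N + m : ℤ) = q ^ ((k - N : ℤ) + 1) * q ^ (m - k) := by
        rw [← zpow_natCast, ← zpow_add₀ hq]; congr 1; push_cast [hk']; ring
      rw [h2]; ring
    have e2 : ∑ k ∈ Finset.range (m + 1), f (k - N) * qbin q m k =
        ∑ k ∈ Finset.range (m + 1), f ((k + 1 : ℕ) - N) * qbin q m (k + 1)
          + f ((0 : ℕ) - N) * qbin q (m + 1) 0 := by
      rw [qbin_zero, ← qbin_zero q m,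
        ← Finset.sum_range_succ' (fun k : ℕ => f (k - N) * qbin q m k) (m + 1),
        Finset.sum_range_succ _ (m + 1), qbin_gt q m (m + 1) (by omega)]
      simp
    rw [e1]
    linear_combination e2

lemma half_prod (q w : ℂ) (hq : q ≠ 0) (hw : w ≠ 0) (f : ℤ → ℂ) (h0 : f 0 = 1)
    (hf : ∀ j, f (j + 1) = -w * q ^ (j + 1) * f j) (N : ℕ) :
    f (-N) * ∏ k ∈ Finset.range N, (1 - w * q ^ (1 - N + k : ℤ)) =
      ∏ k ∈ Finset.range N, (1 - q ^ k * w⁻¹) := by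
  induction N with
  | zero => simp [h0]
  | succ N ih =>
    rw [Finset.prod_range_succ', Finset.prod_range_succ, ← ih]
    have h1 := hf (-(N + 1 : ℕ))
    have h2 : (-(N + 1 : ℕ) + 1 : ℤ) = -N := by push_cast; ring
    rw [h2] at h1
    have h3 : (1 - (N + 1 : ℕ) + (0 : ℕ) : ℤ) = -N := by push_cast; ring
    have h4 : ∀ k : ℕ, (1 - (N + 1 : ℕ) + (k + 1 : ℕ) : ℤ) = 1 - N + k := by
      intro k; push_cast; ring
    simp only [h3, h4]
    rw [h1]
    rw [zpow_neg, zpow_natCast]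
    have : q ^ N ≠ 0 := pow_ne_zero _ hq
    field_simp
    ring

lemma finite_triple (q w : ℂ) (hq : q ≠ 0) (hw : w ≠ 0) (f : ℤ → ℂ) (h0 : f 0 = 1)
    (hf : ∀ j, f (j + 1) = -w * q ^ (j + 1) * f j) (N : ℕ) :
    (∏ k ∈ Finset.range N, (1 - q ^ k * w⁻¹)) * ∏ k ∈ Finset.range N, (1 - q ^ (k + 1) * w) =
      ∑ k ∈ Finset.range (2 * N + 1), f (k - N) * qbin q (2 * N) k := by
  rw [← qbinomial q w hq f hf N (2 * N), two_mul, Finset.prod_range_add, ← mul_assoc,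
    half_prod q w hq hw f h0 hf N]
  congr 1
  refine Finset.prod_congr rfl fun k _ => ?_
  have : (1 - N + (N + k : ℕ) : ℤ) = (k + 1 : ℕ) := by push_cast; ring
  rw [this, zpow_natCast]; ring

/-- coefficient extended by zero -/
def qco (q : ℂ) (N : ℕ) (j : ℤ) : ℂ :=
  if -(N : ℤ) ≤ j then qbin q (2 * N) (j + N).toNat else 0

lemma finite_sum_eq (q : ℂ) (f : ℤ → ℂ) (N : ℕ) :
    ∑ k ∈ Finset.range (2 * N + 1), f (k - N) * qbin q (2 * N) k = ∑' j : ℤ, f j * qco q N j := by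
  have inj : Function.Injective (fun k : ℕ => (k - N : ℤ)) := by
    intro a b h; simp at h; exact h
  rw [← inj.tsum_eq (f := fun j => f j * qco q N j)]
  · rw [tsum_eq_sum (s := Finset.range (2 * N + 1))]
    · refine Finset.sum_congr rfl fun k _ => ?_
      simp [qco]
    · intro k hk
      have : 2 * N < k := by simpa using hk
      simp [qco, qbin_gt q _ _ this]
  · intro j hj
    by_cases h : -(N : ℤ) ≤ j
    · exact ⟨(j + N).toNat, by simp; omega⟩
    · simp [qco, h] at hj

lemma qP_ne (q : ℂ) (hq : ‖q‖ < 1) (i : ℕ) : 1 + -q ^ (i + 1) ≠ 0 := by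
  intro h
  have : q ^ (i + 1) = 1 := by linear_combination -h
  have h2 : ‖q‖ ^ (i + 1) < 1 := pow_lt_one₀ (norm_nonneg _) hq (by omega)
  rw [← norm_pow, this] at h2
  simp at h2

lemma summ_q (q : ℂ) (hq : ‖q‖ < 1) (c : ℂ) : Summable fun n : ℕ => ‖-(q ^ (n + 1) * c)‖ := by
  simpa using ((summable_nat_add_iff 1).mpr
    (summable_geometric_of_lt_one (norm_nonneg _) hq)).mul_right ‖c‖

lemma mult_q (q : ℂ) (hq : ‖q‖ < 1) (c : ℂ) : Multipliable fun n : ℕ => (1 - q ^ (n + 1) * c) := by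
  simpa [sub_eq_add_neg] using multipliable_one_add_of_summable (summ_q q hq c)

lemma qP_lim (q : ℂ) (hq : ‖q‖ < 1) :
    ∃ L : ℂ, L ≠ 0 ∧ L = ∏' n : ℕ, (1 - q ^ (n + 1)) ∧ Tendsto (qP q) atTop (nhds L) := by
  refine ⟨_, ?_, rfl, ?_⟩
  · have := tprod_one_add_ne_zero_of_summable (f := fun n : ℕ => -q ^ (n + 1)) (qP_ne q hq)
      (by simpa using summ_q q hq 1)
    simpa [sub_eq_add_neg] using this
  · have := (mult_q q hq 1).tendsto_prod_tprod_nat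
    simp only [mul_one] at this
    exact this

lemma qP_ne' (q : ℂ) (hq : ‖q‖ < 1) (n : ℕ) : qP q n ≠ 0 := by
  refine Finset.prod_ne_zero_iff.mpr fun i _ => ?_
  simpa [sub_eq_add_neg] using qP_ne q hq i

lemma qbin_eq (q : ℂ) (hq : ‖q‖ < 1) (k l : ℕ) :
    qbin q (k + l) k = qP q (k + l) * ((qP q k)⁻¹ * (qP q l)⁻¹) := by
  have := qbin_mul q (k + l) k l rfl
  have h1 := qP_ne' q hq k
  have h2 := qP_ne' q hq l
  rw [← this]; field_simp

lemma qbin_bdd (q : ℂ) (hq : ‖q‖ < 1) : ∃ C : ℝ, ∀ m k, ‖qbin q m k‖ ≤ C := by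
  obtain ⟨L, hL, -, ht⟩ := qP_lim q hq
  obtain ⟨A, hA⟩ := ht.norm.bddAbove_range
  obtain ⟨B, hB⟩ := (ht.inv₀ hL).norm.bddAbove_range
  have hA' : ∀ n, ‖qP q n‖ ≤ A := fun n => hA ⟨n, rfl⟩
  have hB' : ∀ n, ‖(qP q n)⁻¹‖ ≤ B := fun n => hB ⟨n, rfl⟩
  have A0 : 0 ≤ A := (norm_nonneg _).trans (hA' 0)
  have B0 : 0 ≤ B := (norm_nonneg _).trans (hB' 0)
  refine ⟨A * (B * B), fun m k => ?_⟩
  rcases le_or_gt k m with h | h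
  · obtain ⟨l, rfl⟩ := Nat.exists_eq_add_of_le h
    rw [qbin_eq q hq, norm_mul, norm_mul]
    gcongr
    · exact hA' _
    · exact hB' _
    · exact hB' _
  · rw [qbin_gt q m k h, norm_zero]; positivity

lemma qco_bdd (q : ℂ) (hq : ‖q‖ < 1) : ∃ C : ℝ, ∀ N j, ‖qco q N j‖ ≤ C := by
  obtain ⟨C, hC⟩ := qbin_bdd q hq
  refine ⟨C, fun N j => ?_⟩
  unfold qco
  split_ifs
  · exact hC _ _
  · simpa using (norm_nonneg _).trans (hC 0 0)

lemma qco_lim (q : ℂ) (hq : ‖q‖ < 1) (j : ℤ) :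
    Tendsto (fun N => qco q N j) atTop (nhds (∏' n : ℕ, (1 - q ^ (n + 1)))⁻¹) := by
  obtain ⟨L, hL, hL', ht⟩ := qP_lim q hq
  rw [← hL']
  have a1 : Tendsto (fun N : ℕ => (N + j).toNat) atTop atTop := by
    refine tendsto_atTop.mpr fun b => ?_
    filter_upwards [eventually_ge_atTop (b + j.natAbs)] with N hN
    omega
  have a2 : Tendsto (fun N : ℕ => (N - j).toNat) atTop atTop := by
    refine tendsto_atTop.mpr fun b => ?_
    filter_upwards [eventually_ge_atTop (b + j.natAbs)] with N hN
    omega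
  have a3 : Tendsto (fun N : ℕ => 2 * N) atTop atTop := by
    refine tendsto_atTop.mpr fun b => ?_
    filter_upwards [eventually_ge_atTop b] with N hN
    omega
  have key := (ht.comp a3).mul (((ht.comp a1).inv₀ hL).mul ((ht.comp a2).inv₀ hL))
  have e : L * (L⁻¹ * L⁻¹) = L⁻¹ := by field_simp
  rw [e] at key
  refine key.congr' ?_
  filter_upwards [eventually_ge_atTop j.natAbs] with N hN
  have h1 : -(N : ℤ) ≤ j := by omega
  have h2 : 2 * N = (N + j).toNat + (N - j).toNat := by omega
  simp only [qco, h1, if_true, Function.comp]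
  rw [add_comm j, h2, qbin_eq q hq]

lemma triple (q w : ℂ) (hq : q ≠ 0) (hq1 : ‖q‖ < 1) (hw : w ≠ 0) (f : ℤ → ℂ) (h0 : f 0 = 1)
    (hf : ∀ j, f (j + 1) = -w * q ^ (j + 1) * f j) (hs : Summable f) :
    ∑' j, f j = (1 - w⁻¹) * ∏' n : ℕ,
      ((1 - q ^ (n + 1)) * (1 - q ^ (n + 1) * w) * (1 - q ^ (n + 1) * w⁻¹)) := by
  obtain ⟨C, hC⟩ := qco_bdd q hq1
  have T : Tendsto (fun N => ∑' j, f j * qco q N j) atTop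
      (nhds (∑' j, f j * (∏' n : ℕ, (1 - q ^ (n + 1)))⁻¹)) := by
    refine tendsto_tsum_of_dominated_convergence (bound := fun j => ‖f j‖ * C)
      (hs.norm.mul_right C) (fun j => (qco_lim q hq1 j).const_mul _) ?_
    refine Eventually.of_forall fun N j => ?_
    rw [norm_mul]
    exact mul_le_mul_of_nonneg_left (hC N j) (norm_nonneg _)
  simp only [← finite_sum_eq, ← finite_triple q w hq hw f h0 hf] at T
  have m1 := mult_q q hq1 w
  have m2 := mult_q q hq1 w⁻¹
  have m0 := mult_q q hq1 1
  simp only [mul_one] at m0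
  have T2 : Tendsto (fun N => ∏ k ∈ Finset.range N, (1 - q ^ k * w⁻¹)) atTop
      (nhds ((∏' n : ℕ, (1 - q ^ (n + 1) * w⁻¹)) * (1 - w⁻¹))) := by
    rw [← tendsto_add_atTop_iff_nat 1]
    simp only [Finset.prod_range_succ']
    simpa using m2.tendsto_prod_tprod_nat.mul_const (1 - w⁻¹)
  have := tendsto_nhds_unique T (T2.mul m1.tendsto_prod_tprod_nat)
  rw [tsum_mul_right] at this
  obtain ⟨L, hL, hL', -⟩ := qP_lim q hq1
  rw [(m0.mul m1).tprod_mul m2, m0.tprod_mul m1]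
  rw [← hL'] at this ⊢
  rw [← div_eq_mul_inv, div_eq_iff hL] at this
  rw [this]
  ring

/-- Product expansion of θ11:
`Σ_{n∈ℤ}(−1)ⁿ exp(πi(n+1/2)²τ + (2n+1)πiz)
  = q^{1/8}(e^{πiz} − e^{−πiz})·∏_{n≥1}(1−qⁿ)(1−qⁿe^{2πiz})(1−qⁿe^{−2πiz})`,
with the infinite product convergent. -/
theorem θ11_product_expansion (z τ : ℂ) (hτ : 0 < τ.im) :
    Multipliable (fun n : ℕ =>
      (1 - Complex.exp (2 * (Real.pi : ℂ) * I * τ) ^ (n + 1)) *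
      (1 - Complex.exp (2 * (Real.pi : ℂ) * I * τ) ^ (n + 1) *
          Complex.exp (2 * (Real.pi : ℂ) * I * z)) *
      (1 - Complex.exp (2 * (Real.pi : ℂ) * I * τ) ^ (n + 1) *
          Complex.exp (-(2 : ℂ) * (Real.pi : ℂ) * I * z))) ∧
    (∑' n : ℤ, (-1 : ℂ) ^ n * Complex.exp ((Real.pi : ℂ) * I * (n + 1 / 2) ^ 2 * τ +
        (2 * n + 1) * (Real.pi : ℂ) * I * z))
      = Complex.exp ((Real.pi : ℂ) * I * τ / 4) *
        (Complex.exp ((Real.pi : ℂ) * I * z) - Complex.exp (-(Real.pi : ℂ) * I * z)) *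
        ∏' n : ℕ,
          (1 - Complex.exp (2 * (Real.pi : ℂ) * I * τ) ^ (n + 1)) *
          (1 - Complex.exp (2 * (Real.pi : ℂ) * I * τ) ^ (n + 1) *
              Complex.exp (2 * (Real.pi : ℂ) * I * z)) *
          (1 - Complex.exp (2 * (Real.pi : ℂ) * I * τ) ^ (n + 1) *
              Complex.exp (-(2 : ℂ) * (Real.pi : ℂ) * I * z)) := by
  set q := Complex.exp (2 * (Real.pi : ℂ) * I * τ) with hqdef
  set w := Complex.exp (2 * (Real.pi : ℂ) * I * z) with hwdef
  have hwi : Complex.exp (-(2 : ℂ) * (Real.pi : ℂ) * I * z) = w⁻¹ := by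
    rw [hwdef, ← Complex.exp_neg]; congr 1; ring
  have hq : q ≠ 0 := Complex.exp_ne_zero _
  have hw : w ≠ 0 := Complex.exp_ne_zero _
  have hq1 : ‖q‖ < 1 := by
    rw [hqdef, Complex.norm_exp, Real.exp_lt_one_iff]
    have : (2 * (Real.pi : ℂ) * I * τ).re = -(2 * Real.pi * τ.im) := by simp
    rw [this]
    have := Real.pi_pos
    have : 0 < 2 * Real.pi * τ.im := by positivity
    linarith
  rw [hwi]
  have m0 := mult_q q hq1 1
  simp only [mul_one] at m0
  refine ⟨(m0.mul (mult_q q hq1 w)).mul (mult_q q hq1 w⁻¹), ?_⟩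
  have hterm : ∀ n : ℤ, (-1 : ℂ) ^ n * Complex.exp ((Real.pi : ℂ) * I * (n + 1 / 2) ^ 2 * τ +
        (2 * n + 1) * (Real.pi : ℂ) * I * z) =
      Complex.exp ((Real.pi : ℂ) * I * τ / 4) * Complex.exp ((Real.pi : ℂ) * I * z) *
        jacobiTheta₂_term n (z + τ / 2 + 1 / 2) τ := by
    intro n
    have : (-1 : ℂ) ^ n = Complex.exp (n * (Real.pi * I)) := by
      rw [Complex.exp_int_mul, Complex.exp_pi_mul_I]
    rw [this, jacobiTheta₂_term, ← Complex.exp_add, ← Complex.exp_add, ← Complex.exp_add]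
    congr 1; ring
  simp only [hterm]
  rw [tsum_mul_left, triple q w hq hq1 hw (fun n => jacobiTheta₂_term n (z + τ / 2 + 1 / 2) τ)
    (by simp [jacobiTheta₂_term]) ?_ ((summable_jacobiTheta₂_term_iff _ _).mpr hτ)]
  · have h1 : Complex.exp ((Real.pi : ℂ) * I * z) * (1 - w⁻¹) =
      Complex.exp ((Real.pi : ℂ) * I * z) - Complex.exp (-(Real.pi : ℂ) * I * z) := by
      rw [mul_sub, mul_one, hwdef, ← Complex.exp_neg, ← Complex.exp_add]
      congr 2; ring
    rw [← h1]; ring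
  · intro j
    have h1 : -w = Complex.exp (Real.pi * I + 2 * (Real.pi : ℂ) * I * z) := by
      rw [Complex.exp_add, Complex.exp_pi_mul_I]; ring
    rw [h1, hqdef, ← Complex.exp_int_mul, jacobiTheta₂_term, jacobiTheta₂_term,
      ← Complex.exp_add, ← Complex.exp_add]
    congr 1; push_cast; ring

end
end

section
/- Functional equations of the Dedekind eta function: for every τ ∈ ℍ, η(τ+1) = exp(πi/12)·η(τ) and η(−1/τ) = √(−iτ)·η(τ), where √ denotes the principal branch of the complex square root (note that Re(−iτ) > 0 for τ ∈ ℍ, so the principal square root is well defined and nonzero). -/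
open Complex Filter

noncomputable section

theorem eta_eq_mathlib (z : ℂ) : η z = ModularForm.eta z := by
  unfold η ModularForm.eta
  congr 1
  · unfold Function.Periodic.qParam
    congr 1
    push_cast
    ring
  · refine tprod_congr fun n => ?_
    rw [ModularForm.eta_q_eq_pow]

theorem sqrt_aux (τ : ℂ) (hτ : 0 < τ.im) :
    τ ^ ((1 : ℂ) / 2) = (-I * τ) ^ ((1 : ℂ) / 2) * I ^ ((1 : ℂ) / 2) := by
  have h0 : -I * τ ≠ 0 := by
    intro h
    have : τ = 0 := by simpa using h
    simp [this] at hτ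
  have h1 : τ = (-I * τ) * I := by
    linear_combination τ * I_sq
  have hre : 0 < (-I * τ).re := by simpa using hτ
  have ha := abs_lt.mp (Complex.abs_arg_lt_pi_div_two_iff.mpr (Or.inl hre))
  have hl : Complex.log (-I * τ * I) = Complex.log (-I * τ) + Complex.log I := by
    apply Complex.log_mul h0 I_ne_zero
    rw [Complex.arg_I]
    constructor <;> linarith [Real.pi_pos, ha.1, ha.2]
  conv_lhs => rw [h1]
  rw [Complex.cpow_def_of_ne_zero (mul_ne_zero h0 I_ne_zero), Complex.cpow_def_of_ne_zero h0,
    Complex.cpow_def_of_ne_zero I_ne_zero, ← Complex.exp_add, hl, add_mul]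

/-- Functional equations of the Dedekind eta function:
`η(τ+1) = e^{πi/12}·η(τ)` and `η(−1/τ) = √(−iτ)·η(τ)`, where the square root is the
principal branch of the complex power. -/
theorem eta_functional_equations (τ : ℂ) (hτ : 0 < τ.im) :
    η (τ + 1) = Complex.exp ((Real.pi : ℂ) * I / 12) * η τ ∧
    η (-1 / τ) = (-I * τ) ^ ((1 : ℂ) / 2) * η τ := by
  constructor
  · unfold η
    have h : Complex.exp (2 * (Real.pi : ℂ) * I * (τ + 1)) =
        Complex.exp (2 * (Real.pi : ℂ) * I * τ) := by
      rw [mul_add, mul_one, Complex.exp_add, Complex.exp_two_pi_mul_I, mul_one]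
    rw [h, ← mul_assoc, ← Complex.exp_add]
    congr 2
    ring
  · have h := ModularForm.eta_comp_eq_csqrt_I_inv (x := τ) hτ
    have hs := sqrt_aux τ hτ
    have hI : I ^ ((1 : ℂ) / 2) ≠ 0 := by simp [Complex.cpow_eq_zero_iff]
    rw [eta_eq_mathlib, eta_eq_mathlib]
    simp only [Function.comp_apply, Pi.smul_apply, Pi.mul_apply, smul_eq_mul, Complex.sqrt,
      ← one_div] at h
    rw [h, hs]
    field_simp

end
end
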